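/- Let f : ℝ × ℝ → ℝ be the Goldstein–Price function f(x₁, x₂) = (1 + (x₁ + x₂ + 1)²·(19 - 14x₁ + 3x₁² + 6x₁x₂ - 14x₂ + 3x₂²))·(30 + (2x₁ - 3x₂)²·(18 - 32x₁ + 12x₁² - 36x₁x₂ + 48x₂ + 27x₂²)). Then f(0, -1) = 3, and f(x₁, x₂) ≥ 3 for all (x₁, x₂) with -2 ≤ x₁ ≤ 2 and -2 ≤ x₂ ≤ 2; thus (0, -1) is a global minimum point of f on [-2, 2]² with minimum value 3. -/

import Mathlib

open Real

/-- The Goldstein–Price function on ℝ². -/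
noncomputable def goldsteinPrice (x₁ x₂ : ℝ) : ℝ :=
  (1 + (x₁ + x₂ + 1) ^ 2 *
      (19 - 14 * x₁ + 3 * x₁ ^ 2 + 6 * x₁ * x₂ - 14 * x₂ + 3 * x₂ ^ 2)) *
    (30 + (2 * x₁ - 3 * x₂) ^ 2 *
      (18 - 32 * x₁ + 12 * x₁ ^ 2 - 36 * x₁ * x₂ + 48 * x₂ + 27 * x₂ ^ 2))

theorem goldsteinPrice_global_min :
    goldsteinPrice 0 (-1) = 3 ∧
    (∀ x₁ x₂ : ℝ, -2 ≤ x₁ → x₁ ≤ 2 → -2 ≤ x₂ → x₂ ≤ 2 → 3 ≤ goldsteinPrice x₁ x₂) := by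
  refine ⟨by norm_num [goldsteinPrice], ?_⟩
  intro x y _ _ _ _
  unfold goldsteinPrice
  -- with u = x + y and v = 2x - 3y the function splits as A(u) * B(v)
  have hA : 1 ≤ 1 + (x + y + 1) ^ 2 *
      (19 - 14 * x + 3 * x ^ 2 + 6 * x * y - 14 * y + 3 * y ^ 2) := by
    have h : 0 ≤ 19 - 14 * x + 3 * x ^ 2 + 6 * x * y - 14 * y + 3 * y ^ 2 := by
      nlinarith [sq_nonneg (3 * (x + y) - 7)]
    have := mul_nonneg (sq_nonneg (x + y + 1)) h
    linarith
  have hB : 3 ≤ 30 + (2 * x - 3 * y) ^ 2 *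
      (18 - 32 * x + 12 * x ^ 2 - 36 * x * y + 48 * y + 27 * y ^ 2) := by
    have h : 0 ≤ (2 * x - 3 * y - 3) ^ 2 *
        (2 * (2 * x - 3 * y) ^ 2 + (2 * x - 3 * y + 1) ^ 2 + 2) := by positivity
    linarith
  nlinarith [mul_nonneg (sub_nonneg.mpr hA) (sub_nonneg.mpr hB)]
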